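/- Fix an integer d ≥ 3 and set s = d − 1. For n ≥ 1 and 0 ≤ k ≤ n define λ_k² = (W_{n−k,2k}^{(d)})² / W_{2n}^{(d)} with multiplicities I_0 = 1 and I_{2k} = d(d−1)^{2k−1} for k ≥ 1, and define the pair-flip half-chain entropy S_n^{PF} = −Σ_{k=0}^{n} I_{2k} λ_k² log₂ λ_k². Similarly define μ_k² = (s^{n−k} C_{n−k,2k})² / (s^{2n} C_{2n}) with multiplicities J_0 = 1 and J_{2k} = s^{2k} for k ≥ 1, and the s-colored Dyck half-chain entropy S_n^{D} = −Σ_{k=0}^{n} J_{2k} μ_k² log₂ μ_k². Then there exists a constant C > 0 such that for all n ≥ 1: S_n^{PF} ≥ ((d−2)/(d−1))² · S_n^{D} − C and S_n^{PF} ≤ (d/(d−2))² · S_n^{D} + C. -/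

import Mathlib

open scoped Classical

/-- One step of the stack-based reduction: push the letter if the stack is empty or
its top differs from the current letter, otherwise pop the top. -/
def redStep {d : ℕ} (s : List (Fin d)) (a : Fin d) : List (Fin d) :=
  match s with
  | [] => [a]
  | b :: rest => if a = b then rest else a :: b :: rest

/-- The irreducible string of a word: the final stack content read from bottom to top. -/
def irrOf {d N : ℕ} (w : Fin N → Fin d) : List (Fin d) :=
  ((List.ofFn w).foldl redStep []).reverse

/-- A word is fully reducible if its irreducible string is empty. -/
def FullyReducible {d N : ℕ} (w : Fin N → Fin d) : Prop := irrOf w = []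

/-- `W d m` is the number of fully reducible words of length `2m` over `{1,…,d}`. -/
noncomputable def W (d m : ℕ) : ℕ :=
  Nat.card {w : Fin (2 * m) → Fin d // FullyReducible w}

/-- `Wx d N x` is the number of words of length `N` over `{1,…,d}` whose irreducible
string equals `x`. -/
noncomputable def Wx (d N : ℕ) (x : List (Fin d)) : ℕ :=
  Nat.card {w : Fin N → Fin d // irrOf w = x}

/-- `Cnk m j = ((j+1)/(m+j+1)) · binomial(2m+j, m)`, as a real number: the number of
nonnegative lattice paths with `m` down-steps ending at height `j`. -/
noncomputable def Cnk (m j : ℕ) : ℝ :=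
  ((j + 1) * Nat.choose (2 * m + j) m : ℝ) / ((m + j + 1 : ℕ) : ℝ)

/-- `λ_k² = (W_{n−k,2k}^{(d)})² / W_{2n}^{(d)}`, with `x k` the chosen irreducible
string of length `2k` (`x 0 = []`). -/
noncomputable def lamSq (d n : ℕ) (x : ℕ → List (Fin d)) (k : ℕ) : ℝ :=
  (Wx d (2 * n) (x k) : ℝ) ^ 2 / (W d (2 * n) : ℝ)

/-- Multiplicities `I_0 = 1` and `I_{2k} = d(d−1)^{2k−1}` for `k ≥ 1`. -/
def Imult (d k : ℕ) : ℕ := if k = 0 then 1 else d * (d - 1) ^ (2 * k - 1)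

/-- The pair-flip half-chain entropy
`S_n^{PF} = −Σ_{k=0}^{n} I_{2k} λ_k² log₂ λ_k²`. -/
noncomputable def SPF (d n : ℕ) (x : ℕ → List (Fin d)) : ℝ :=
  - ∑ k ∈ Finset.range (n + 1),
      (Imult d k : ℝ) * lamSq d n x k * Real.logb 2 (lamSq d n x k)

/-- `μ_k² = (s^{n−k} C_{n−k,2k})² / (s^{2n} C_{2n})`. -/
noncomputable def muSq (s n k : ℕ) : ℝ :=
  ((s : ℝ) ^ (n - k) * Cnk (n - k) (2 * k)) ^ 2 /
    ((s : ℝ) ^ (2 * n) * (catalan (2 * n) : ℝ))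

/-- Multiplicities `J_0 = 1` and `J_{2k} = s^{2k}` for `k ≥ 1`. -/
def Jmult (s k : ℕ) : ℕ := if k = 0 then 1 else s ^ (2 * k)

/-- The `s`-colored Dyck half-chain entropy
`S_n^{D} = −Σ_{k=0}^{n} J_{2k} μ_k² log₂ μ_k²`. -/
noncomputable def SD (s n : ℕ) : ℝ :=
  - ∑ k ∈ Finset.range (n + 1),
      (Jmult s k : ℝ) * muSq s n k * Real.logb 2 (muSq s n k)

/-- `s`-colored nonnegative paths with `N` steps ending at height `h`
(with a given coloring of the unmatched up-steps). -/
def pathF (s : ℕ) : ℕ → ℕ → ℕ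
  | 0, 0 => 1
  | 0, _ + 1 => 0
  | N + 1, 0 => s * pathF s N 1
  | N + 1, h + 1 => pathF s N h + s * pathF s N (h + 2)

/-- words of length `N` with a given irreducible string of length `h` over `s+1` letters. -/
def pathG (s : ℕ) : ℕ → ℕ → ℕ
  | 0, 0 => 1
  | 0, _ + 1 => 0
  | N + 1, 0 => (s + 1) * pathG s N 1
  | N + 1, h + 1 => pathG s N h + s * pathG s N (h + 2)

lemma pathF_zero_of_lt (s : ℕ) : ∀ N h, N < h → pathF s N h = 0
  | 0, 0, h => absurd h (by simp)
  | 0, _ + 1, _ => by simp [pathF]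
  | N + 1, 0, h => absurd h (by simp)
  | N + 1, h + 1, hh => by
      simp [pathF, pathF_zero_of_lt s N h (by omega), pathF_zero_of_lt s N (h + 2) (by omega)]

lemma pathG_eq (s : ℕ) : ∀ N h M, N ≤ h + 2 * M →
    pathG s N h = ∑ i ∈ Finset.range (M + 1), pathF s N (h + 2 * i) := by
  intro N
  induction N with
  | zero =>
    intro h M _
    cases h with
    | zero =>
      rw [Finset.sum_range_succ']
      simp only [pathG, pathF, Nat.mul_zero, Nat.add_zero]
      rw [Finset.sum_eq_zero]
      intro i _
      exact pathF_zero_of_lt _ _ _ (by omega)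
    | succ h =>
      rw [Finset.sum_eq_zero]
      · simp [pathG]
      intro i _
      exact pathF_zero_of_lt _ _ _ (by omega)
  | succ N ih =>
    intro h M hM
    cases h with
    | zero =>
      rw [Finset.sum_range_succ', pathG]
      have e1 : ∀ i, pathF s (N + 1) (0 + 2 * (i + 1)) =
          pathF s N (1 + 2 * i) + s * pathF s N (1 + 2 * (i + 1)) := by
        intro i
        rw [show 0 + 2 * (i + 1) = (1 + 2 * i) + 1 by ring, pathF]
        congr 3
      simp only [e1, Finset.sum_add_distrib]
      have e2 := ih 1 M (by omega)
      have e3 : pathF s N (1 + 2 * M) = 0 := pathF_zero_of_lt _ _ _ (by omega)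
      have e4 := e2
      rw [Finset.sum_range_succ, e3] at e2
      rw [Finset.sum_range_succ'] at e4
      rw [← Finset.mul_sum]
      simp only [Nat.mul_zero, Nat.add_zero] at *
      rw [← e2, pathF]
      have : s * pathG s N 1 = s * (∑ k ∈ Finset.range M, pathF s N (1 + 2 * (k + 1))) + s * pathF s N 1 := by
        rw [e4]; ring
      linarith
    | succ h =>
      rw [pathG, ih h M.succ (by omega), ih (h + 2) M (by omega)]
      have e1 : ∀ i, pathF s (N + 1) (h + 1 + 2 * i) =
          pathF s N (h + 2 * i) + s * pathF s N (h + 2 + 2 * i) := by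
        intro i
        rw [show h + 1 + 2 * i = (h + 2 * i) + 1 by ring, pathF]
        congr 3; ring
      simp only [e1, Finset.sum_add_distrib, Finset.mul_sum]
      rw [Finset.sum_range_succ _ (M.succ), pathF_zero_of_lt s N (h + 2 * M.succ) (by omega)]
      simp

/-- self-adjointness -/
lemma pathF_adj (s N M K : ℕ) (hK : N + M < K) :
    ∑ h ∈ Finset.range K, s ^ h * pathF s (N + 1) h * pathF s M h =
      ∑ h ∈ Finset.range K, s ^ h * pathF s N h * pathF s (M + 1) h := by
  have key : ∀ N M, N + M < K → ∑ h ∈ Finset.range K, s ^ h * pathF s (N + 1) h * pathF s M h =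
      ∑ h ∈ Finset.range K, (s ^ (h + 1) * pathF s N h * pathF s M (h + 1) +
        s ^ (h + 1) * pathF s N (h + 1) * pathF s M h) := by
    intro N M hK
    obtain ⟨K, rfl⟩ : ∃ K', K = K' + 1 := ⟨K - 1, by omega⟩
    rw [Finset.sum_add_distrib, Finset.sum_range_succ', Finset.sum_range_succ,
      Finset.sum_range_succ' (fun h => s ^ (h + 1) * pathF s N (h + 1) * pathF s M h)]
    have : pathF s N K * pathF s M (K + 1) = 0 := by
      rw [pathF_zero_of_lt s M (K + 1) (by omega)]; simp
    rw [mul_assoc (s ^ (K + 1)), this]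
    have e : ∀ h, s ^ (h + 1) * pathF s (N + 1) (h + 1) * pathF s M (h + 1) =
      s ^ (h + 1) * pathF s N h * pathF s M (h + 1) +
        s ^ (h + 1 + 1) * pathF s N (h + 1 + 1) * pathF s M (h + 1) := by
      intro h; rw [pathF]; ring
    simp only [e, Finset.sum_add_distrib]
    rw [pathF]; simp only [zero_add]; ring
  rw [key N M hK]
  have := key M N (by omega)
  have e : ∀ h, s ^ h * pathF s N h * pathF s (M + 1) h = s ^ h * pathF s (M + 1) h * pathF s N h := by
    intro h; ring
  simp only [e, this]
  apply Finset.sum_congr rfl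
  intro h _; ring

lemma pathF_conv (s K : ℕ) : ∀ N M, N + M < K →
    ∑ h ∈ Finset.range K, s ^ h * pathF s N h * pathF s M h = pathF s (N + M) 0 := by
  intro N
  induction N with
  | zero =>
    intro M hM
    obtain ⟨K, rfl⟩ : ∃ K', K = K' + 1 := ⟨K - 1, by omega⟩
    rw [Finset.sum_range_succ']
    simp [pathF]
  | succ N ih =>
    intro M hM
    rw [pathF_adj s N M K (by omega), ih (M + 1) (by omega)]
    congr 1; ring

lemma Cnk_zero (h : ℕ) : Cnk 0 h = 1 := by
  unfold Cnk
  simp only [Nat.choose_zero_right]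
  push_cast
  have : (h : ℝ) + 1 ≠ 0 := by positivity
  field_simp
  ring

lemma Cnk_pos (m h : ℕ) : 0 < Cnk m h := by
  unfold Cnk
  have : 0 < Nat.choose (2 * m + h) m := Nat.choose_pos (by omega)
  positivity

lemma Cnk_step (m j : ℕ) :
    Cnk m (j + 2) * (((j : ℝ) + 1) * (m + j + 3)) = Cnk (m + 1) j * ((j + 3) * (m + 1)) := by
  unfold Cnk
  have h := Nat.choose_succ_right_eq (2 * m + (j + 2)) m
  rw [show 2 * m + (j + 2) - m = m + j + 2 by omega] at h
  rw [show 2 * (m + 1) + j = 2 * m + (j + 2) by ring]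
  have h' : ((2 * m + (j + 2)).choose (m + 1) : ℝ) * (m + 1) =
    (2 * m + (j + 2)).choose m * (m + j + 2) := by exact_mod_cast h
  push_cast
  have a1 : (m : ℝ) + (j + 2) + 1 ≠ 0 := by positivity
  have a2 : (m : ℝ) + 1 + j + 1 ≠ 0 := by positivity
  field_simp
  linear_combination (-(j + 3 : ℝ) * (m + (j + 2) + 1)) * h'

lemma Cnk_rec0 (m : ℕ) : Cnk (m + 1) 0 = Cnk m 1 := by
  unfold Cnk
  have h := Nat.choose_succ_right_eq (2 * m + 1) m
  rw [show 2 * m + 1 - m = m + 1 by omega] at h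
  have h' : ((2 * m + 1).choose (m + 1) : ℝ) * (m + 1) =
    (2 * m + 1).choose m * (m + 1) := by exact_mod_cast h
  have p : ((2 * (m + 1) + 0).choose (m + 1) : ℝ) =
      (2 * m + 1).choose m + (2 * m + 1).choose (m + 1) := by
    rw [show 2 * (m + 1) + 0 = (2 * m + 1) + 1 by ring, Nat.choose_succ_succ]; push_cast; ring
  rw [p]
  have a : (m : ℝ) + 1 ≠ 0 := by positivity
  have h2 : ((2 * m + 1).choose (m + 1) : ℝ) = (2 * m + 1).choose m := mul_right_cancel₀ a h'
  rw [h2]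
  push_cast
  have a2 : (m : ℝ) + 1 + 1 ≠ 0 := by positivity
  field_simp
  ring

lemma Cnk_rec (m j : ℕ) : Cnk (m + 1) (j + 1) = Cnk (m + 1) j + Cnk m (j + 2) := by
  have hs := Cnk_step m j
  have a3 : ((j : ℝ) + 1) * (m + j + 3) ≠ 0 := by positivity
  have hs' : Cnk m (j + 2) = Cnk (m + 1) j * ((j + 3) * (m + 1)) / (((j : ℝ) + 1) * (m + j + 3)) := by
    rw [eq_div_iff a3, hs]
  rw [hs']
  unfold Cnk
  have h := Nat.add_one_mul_choose_eq (2 * m + j + 2) (m + 1)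
  have h0 := Nat.choose_mul_succ_eq (2 * m + j + 2) (m + 1)
  rw [show 2 * m + j + 2 + 1 - (m + 1) = m + j + 2 by omega] at h0
  have h' : ((2 * m + j + 2).choose (m + 1) : ℝ) * (2 * m + j + 3) =
    (2 * m + j + 3).choose (m + 1) * (m + j + 2) := by exact_mod_cast h0
  rw [show 2 * (m + 1) + j = 2 * m + j + 2 by ring,
    show 2 * (m + 1) + (j + 1) = 2 * m + j + 3 by ring]
  push_cast
  have a1 : (m : ℝ) + j + 2 ≠ 0 := by positivity
  have h2 : ((2 * m + j + 3).choose (m + 1) : ℝ) =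
    ((2 * m + j + 2).choose (m + 1) : ℝ) * (2 * m + j + 3) / (m + j + 2) := by
    rw [eq_div_iff a1, h']
  rw [h2]
  have a2 : (m : ℝ) + 1 + j + 1 ≠ 0 := by positivity
  have a4 : (m : ℝ) + 1 + (j + 1) + 1 ≠ 0 := by positivity
  have a5 : (m : ℝ) + j + 3 ≠ 0 := by positivity
  have a6 : (j : ℝ) + 1 ≠ 0 := by positivity
  rw [show (m : ℝ) + 1 + j + 1 = m + j + 2 by ring,
    show (m : ℝ) + 1 + (j + 1) + 1 = m + j + 3 by ring]
  field_simp
  ring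

lemma pathF_eq (s : ℕ) : ∀ N m h, N = 2 * m + h → (pathF s N h : ℝ) = (s : ℝ) ^ m * Cnk m h := by
  intro N
  induction N with
  | zero =>
    intro m h e
    obtain rfl : m = 0 := by omega
    obtain rfl : h = 0 := by omega
    simp [pathF, Cnk_zero]
  | succ N ih =>
    intro m h e
    cases h with
    | zero =>
      obtain ⟨m, rfl⟩ : ∃ m', m = m' + 1 := ⟨m - 1, by omega⟩
      rw [pathF, Cnk_rec0]
      push_cast
      rw [ih m 1 (by omega)]
      ring
    | succ h =>
      rw [pathF]
      push_cast
      rw [ih m h (by omega)]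
      cases m with
      | zero =>
        rw [pathF_zero_of_lt s N (h + 2) (by omega)]
        simp [Cnk_zero]
      | succ m =>
        rw [ih m (h + 2) (by omega), Cnk_rec]
        ring

/-- ratio of successive terms -/
noncomputable def ratT (m h i : ℕ) : ℝ :=
  (1 + 2 * (i : ℝ) / (h + 1)) * ∏ l ∈ Finset.range i, (((m - l : ℕ) : ℝ) / (m + h + 2 + l))

lemma ratT_eq (m h : ℕ) : ∀ i, i ≤ m → Cnk (m - i) (h + 2 * i) = Cnk m h * ratT m h i := by
  intro i
  induction i with
  | zero => intro _; simp [ratT]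
  | succ i ih =>
    intro hi
    have ih := ih (by omega)
    obtain ⟨p, rfl⟩ : ∃ p, m = p + (i + 1) := ⟨m - (i + 1), by omega⟩
    have hs := Cnk_step p (h + 2 * i)
    rw [show p + (i + 1) - i = p + 1 by omega] at ih
    rw [ih] at hs
    rw [show p + (i + 1) - (i + 1) = p by omega, show h + 2 * (i + 1) = h + 2 * i + 2 by ring]
    have a3 : (((h + 2 * i : ℕ) : ℝ) + 1) * (p + ((h + 2 * i : ℕ) : ℝ) + 3) ≠ 0 := by positivity
    apply mul_right_cancel₀ a3
    rw [hs]
    unfold ratT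
    rw [Finset.prod_range_succ, show p + (i + 1) - i = p + 1 by omega]
    push_cast
    have a6 : (h : ℝ) + 1 ≠ 0 := by positivity
    have a7 : (p : ℝ) + (i + 1) + h + 2 + i ≠ 0 := by positivity
    field_simp
    ring

lemma ratT_zero (m h i : ℕ) (hi : m < i) : ratT m h i = 0 := by
  unfold ratT
  rw [Finset.prod_eq_zero (Finset.mem_range.2 hi)]
  · simp
  · simp

lemma ratT_nonneg (m h i : ℕ) : 0 ≤ ratT m h i := by
  unfold ratT
  apply mul_nonneg (by positivity)
  exact Finset.prod_nonneg fun l _ => by positivity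

lemma ratT_mono (m h m' i : ℕ) (hm : m ≤ m') : ratT m h i ≤ ratT m' 0 i := by
  unfold ratT
  have : (0 : ℝ) ≤ h := by positivity
  have : (0 : ℝ) ≤ i := by positivity
  apply mul_le_mul
  · gcongr
    simp
  · apply Finset.prod_le_prod
    · intro l _; positivity
    · intro l _
      rcases le_total l m with hl | hl
      · obtain ⟨p, rfl⟩ : ∃ p, m = p + l := ⟨m - l, by omega⟩
        obtain ⟨q, rfl⟩ : ∃ q, m' = p + l + q := ⟨m' - (p + l), by omega⟩
        rw [show p + l - l = p by omega, show p + l + q - l = p + q by omega,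
          div_le_div_iff₀ (by positivity) (by positivity)]
        push_cast
        have : (0 : ℝ) ≤ p * h + q * (l + l + h + 2) := by positivity
        nlinarith
      · rw [show m - l = 0 by omega]
        simp only [Nat.cast_zero, zero_div]
        positivity
  · exact Finset.prod_nonneg fun l _ => by positivity
  · positivity

lemma ratT_le (m h i : ℕ) : ratT m h i ≤ 1 + 2 * i := by
  refine (ratT_mono m h m i le_rfl).trans ?_
  unfold ratT
  have : ∏ l ∈ Finset.range i, (((m - l : ℕ) : ℝ) / (m + (0 : ℕ) + 2 + l)) ≤ 1 := by
    apply Finset.prod_le_one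
    · intro l _; positivity
    · intro l _
      apply div_le_one_of_le₀ _ (by positivity)
      have : ((m - l : ℕ) : ℝ) ≤ m := by exact_mod_cast Nat.sub_le _ _
      have : (0 : ℝ) ≤ l := by positivity
      push_cast
      linarith
  calc _ ≤ (1 + 2 * (i : ℝ) / ((0 : ℕ) + 1)) * 1 := by gcongr
    _ = _ := by simp

/-- the ratio sum -/
noncomputable def ratR (s m h : ℕ) : ℝ :=
  ∑ i ∈ Finset.range (m + 1), ratT m h i / (s : ℝ) ^ i

lemma pathG_ratio (s m h : ℕ) (hs : 1 ≤ s) :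
    (pathG s (2 * m + h) h : ℝ) = pathF s (2 * m + h) h * ratR s m h := by
  rw [pathG_eq s (2 * m + h) h m (by omega)]
  unfold ratR
  push_cast
  rw [Finset.mul_sum]
  apply Finset.sum_congr rfl
  intro i hi
  have hi : i ≤ m := by simpa [Nat.lt_succ_iff] using hi
  rw [pathF_eq s (2 * m + h) (m - i) (h + 2 * i) (by omega), pathF_eq s (2 * m + h) m h rfl,
    ratT_eq m h i hi]
  have hs0 : (s : ℝ) ≠ 0 := by positivity
  have : (s : ℝ) ^ m = s ^ (m - i) * s ^ i := by rw [← pow_add]; congr 1; omega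
  rw [this]
  field_simp

lemma one_le_ratR (s m h : ℕ) : 1 ≤ ratR s m h := by
  unfold ratR
  rw [Finset.sum_range_succ']
  have : ratT m h 0 = 1 := by simp [ratT]
  rw [this]
  have : 0 ≤ ∑ k ∈ Finset.range m, ratT m h (k + 1) / (s : ℝ) ^ (k + 1) :=
    Finset.sum_nonneg fun i _ => div_nonneg (ratT_nonneg _ _ _) (by positivity)
  simpa using this

lemma ratR_mono (s m h m' : ℕ) (hm : m ≤ m') : ratR s m h ≤ ratR s m' 0 := by
  unfold ratR
  calc _ ≤ ∑ i ∈ Finset.range (m + 1), ratT m' 0 i / (s : ℝ) ^ i := by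
        apply Finset.sum_le_sum
        intro i _
        exact div_le_div_of_nonneg_right (ratT_mono _ _ _ _ hm) (by positivity)
    _ ≤ _ := by
        apply Finset.sum_le_sum_of_subset_of_nonneg
        · intro i; simp; omega
        · intro i _ _
          exact div_nonneg (ratT_nonneg _ _ _) (by positivity)

lemma geo_sum (s : ℝ) (hs : 2 ≤ s) (M : ℕ) :
    ∑ i ∈ Finset.range M, (1 + 2 * (i : ℝ)) / s ^ i =
      s * (s + 1) / (s - 1) ^ 2 - (2 * M * s / (s - 1) + s * (s + 1) / (s - 1) ^ 2) / s ^ M := by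
  have h1 : s - 1 ≠ 0 := by intro h; linarith
  have h0 : s ≠ 0 := by intro h; linarith
  induction M with
  | zero => simp
  | succ M ih =>
    rw [Finset.sum_range_succ, ih]
    push_cast
    rw [pow_succ]
    field_simp
    ring

lemma ratR_le (s m h : ℕ) (hs : 2 ≤ s) :
    ratR s m h ≤ (s : ℝ) * (s + 1) / (s - 1) ^ 2 := by
  have hs' : (2 : ℝ) ≤ s := by exact_mod_cast hs
  unfold ratR
  calc _ ≤ ∑ i ∈ Finset.range (m + 1), (1 + 2 * (i : ℝ)) / (s : ℝ) ^ i := by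
        apply Finset.sum_le_sum
        intro i _
        exact div_le_div_of_nonneg_right (ratT_le _ _ _) (by positivity)
    _ ≤ _ := by
        rw [geo_sum s hs']
        have : (0 : ℝ) < s - 1 := by linarith
        have : 0 ≤ (2 * ((m + 1 : ℕ) : ℝ) * s / (s - 1) + s * (s + 1) / (s - 1) ^ 2) / (s : ℝ) ^ (m + 1) := by
          positivity
        linarith

/-! Word counting -/

/-- stack after reading the word -/
def stk {d N : ℕ} (w : Fin N → Fin d) : List (Fin d) := (List.ofFn w).foldl redStep []

lemma stk_snoc {d N : ℕ} (w : Fin N → Fin d) (a : Fin d) :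
    stk (Fin.snoc w a : Fin (N + 1) → Fin d) = redStep (stk w) a := by
  unfold stk
  rw [List.ofFn_succ']
  simp [Fin.snoc_castSucc, Fin.snoc_last, List.concat_eq_append, List.foldl_append]

lemma redStep_chain {d : ℕ} (p : List (Fin d)) (a : Fin d) (hp : p.IsChain (· ≠ ·)) :
    (redStep p a).IsChain (· ≠ ·) := by
  cases p with
  | nil => simp [redStep]
  | cons b t =>
    simp only [redStep]
    split_ifs with h
    · exact hp.tail
    · exact List.isChain_cons_cons.2 ⟨h, hp⟩

lemma foldl_chain {d : ℕ} (l p : List (Fin d)) (hp : p.IsChain (· ≠ ·)) :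
    (l.foldl redStep p).IsChain (· ≠ ·) := by
  induction l generalizing p with
  | nil => exact hp
  | cons a l ih => exact ih _ (redStep_chain p a hp)

lemma stk_chain {d N : ℕ} (w : Fin N → Fin d) : (stk w).IsChain (· ≠ ·) :=
  foldl_chain _ _ (by simp)

/-- count -/
noncomputable def cntS (d N : ℕ) (y : List (Fin d)) : ℕ :=
  ∑ w : Fin N → Fin d, if stk w = y then 1 else 0

lemma cntS_succ (d N : ℕ) (y : List (Fin d)) :
    cntS d (N + 1) y = ∑ a : Fin d, ∑ w : Fin N → Fin d, if redStep (stk w) a = y then 1 else 0 := by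
  unfold cntS
  rw [← Fintype.sum_prod_type' (fun (a : Fin d) (w : Fin N → Fin d) =>
    if redStep (stk w) a = y then (1 : ℕ) else 0)]
  symm
  apply Fintype.sum_equiv (Fin.snocEquiv (fun _ => Fin d))
  rintro ⟨a, w⟩
  have := stk_snoc w a
  simp only [Fin.snocEquiv, Equiv.coe_fn_mk]
  rw [← this]
  rfl

lemma redStep_nil_iff {d : ℕ} (p : List (Fin d)) (a : Fin d) : redStep p a = [] ↔ p = [a] := by
  cases p with
  | nil => simp [redStep]
  | cons b t =>
    simp only [redStep]
    split_ifs with h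
    · subst h; simp
    · simp; intro h'; exact absurd h'.symm h

lemma redStep_cons_iff {d : ℕ} (p t : List (Fin d)) (a b : Fin d) (hp : p.IsChain (· ≠ ·))
    (ht : (b :: t).IsChain (· ≠ ·)) :
    redStep p a = b :: t ↔ p = if a = b then t else a :: b :: t := by
  cases p with
  | nil =>
    simp only [redStep]
    split_ifs with h
    · subst h; simp [eq_comm]
    · simp [h]
  | cons c r =>
    simp only [redStep]
    split_ifs with h h' h'
    · subst h; subst h'
      constructor
      · rintro rfl; simp at hp
      · rintro rfl; simp at ht
    · subst h; simp
    · subst h'; simp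
    · simp only [List.cons.injEq, h', false_and, false_iff, not_and]
      intro h2; exact absurd h2.symm h

lemma cntS_eq (s : ℕ) : ∀ (N : ℕ) (y : List (Fin (s + 1))), y.IsChain (· ≠ ·) →
    cntS (s + 1) N y = pathG s N y.length := by
  intro N
  induction N with
  | zero =>
    intro y _
    cases y <;> simp [cntS, stk, pathG]
  | succ N ih =>
    intro y hy
    rw [cntS_succ]
    cases y with
    | nil =>
      simp only [redStep_nil_iff]
      have : ∀ a : Fin (s + 1), (∑ w : Fin N → Fin (s + 1), if stk w = [a] then 1 else 0) = pathG s N 1 := by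
        intro a
        exact ih [a] (by simp)
      simp only [this]
      simp [pathG]
    | cons b t =>
      have : ∀ a : Fin (s + 1), (∑ w : Fin N → Fin (s + 1), if redStep (stk w) a = b :: t then 1 else 0)
          = if a = b then pathG s N t.length else pathG s N (t.length + 2) := by
        intro a
        simp only [redStep_cons_iff _ t a b (stk_chain _) hy]
        split_ifs with h
        · exact ih t hy.tail
        · exact ih (a :: b :: t) (List.isChain_cons_cons.2 ⟨h, hy⟩)
      simp only [this]
      rw [Finset.sum_ite]
      simp [pathG, Finset.filter_eq', Finset.filter_ne']

lemma Wx_eq (s N : ℕ) (x : List (Fin (s + 1))) (hx : x.IsChain (· ≠ ·)) :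
    Wx (s + 1) N x = pathG s N x.length := by
  have hr : (x.reverse).IsChain (· ≠ ·) := by
    rw [List.isChain_reverse]
    exact hx.imp fun _ _ h => h.symm
  have := cntS_eq s N x.reverse hr
  rw [List.length_reverse] at this
  rw [← this]
  unfold Wx cntS irrOf
  rw [Nat.card_eq_fintype_card, Fintype.card_subtype, Finset.card_filter]
  apply Finset.sum_congr rfl
  intro w _
  simp only [stk, List.reverse_eq_iff]
  congr

lemma W_eq (s m : ℕ) : W (s + 1) m = pathG s (2 * m) 0 :=
  Wx_eq s (2 * m) [] (by simp)

lemma catalan_Cnk (m : ℕ) : (catalan m : ℝ) = Cnk m 0 := by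
  have h := succ_mul_catalan_eq_centralBinom m
  have h' : ((m : ℝ) + 1) * catalan m = (2 * m).choose m := by
    rw [← Nat.centralBinom_eq_two_mul_choose]; exact_mod_cast h
  unfold Cnk
  push_cast
  rw [eq_div_iff (by positivity)]
  simp only [add_zero]
  linarith

lemma muSq_eq (s n k : ℕ) (hk : k ≤ n) :
    muSq s n k = (pathF s (2 * n) (2 * k) : ℝ) ^ 2 / pathF s (4 * n) 0 := by
  unfold muSq
  rw [catalan_Cnk, pathF_eq s (2 * n) (n - k) (2 * k) (by omega),
    pathF_eq s (4 * n) (2 * n) 0 (by omega)]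

lemma sum_muSq (s n : ℕ) (hs : 1 ≤ s) :
    ∑ k ∈ Finset.range (n + 1), (Jmult s k : ℝ) * muSq s n k ≤ 1 := by
  have hF : (0 : ℝ) < pathF s (4 * n) 0 := by
    rw [pathF_eq s (4 * n) (2 * n) 0 (by omega)]
    have := Cnk_pos (2 * n) 0
    positivity
  have h := pathF_conv s (4 * n + 1) (2 * n) (2 * n) (by omega)
  rw [show 2 * n + 2 * n = 4 * n by ring] at h
  have e : ∀ k ∈ Finset.range (n + 1), (Jmult s k : ℝ) * muSq s n k =
      ((s ^ (2 * k) * pathF s (2 * n) (2 * k) * pathF s (2 * n) (2 * k) : ℕ) : ℝ) / pathF s (4 * n) 0 := by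
    intro k hk
    have hk : k ≤ n := by simpa [Nat.lt_succ_iff] using hk
    rw [muSq_eq s n k hk]
    have : Jmult s k = s ^ (2 * k) := by
      unfold Jmult; split_ifs with h
      · simp [h]
      · rfl
    rw [this]; push_cast; ring
  rw [Finset.sum_congr rfl e, ← Finset.sum_div, div_le_one hF, ← h]
  rw [← Nat.cast_sum]
  norm_cast
  rw [← Finset.sum_image (f := fun j => s ^ j * pathF s (2 * n) j * pathF s (2 * n) j)
    (g := fun k => 2 * k) (s := Finset.range (n + 1)) (by intro a _ b _ h; simpa using h)]
  apply Finset.sum_le_sum_of_subset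
  intro j hj
  simp only [Finset.mem_image, Finset.mem_range] at hj ⊢
  obtain ⟨a, ha, rfl⟩ := hj
  omega

lemma Imult_eq (s k : ℕ) (hs : 1 ≤ s) (hk : k ≠ 0) :
    (Imult (s + 1) k : ℝ) = ((s : ℝ) + 1) / s * Jmult s k := by
  unfold Imult Jmult
  simp only [hk, if_false]
  obtain ⟨j, rfl⟩ : ∃ j, k = j + 1 := ⟨k - 1, by omega⟩
  rw [show 2 * (j + 1) - 1 = 2 * j + 1 by omega, show 2 * (j + 1) = 2 * j + 1 + 1 by ring]
  have hs0 : (s : ℝ) ≠ 0 := by positivity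
  push_cast
  field_simp
  ring

lemma neg_mul_logb_le (p : ℝ) (hp : 0 < p) : p * (-Real.logb 2 p) ≤ 2 := by
  have h1 := Real.log_le_sub_one_of_pos (inv_pos.2 hp)
  rw [Real.log_inv] at h1
  have h2 : p * (-Real.log p) ≤ 1 := by
    calc p * (-Real.log p) ≤ p * (p⁻¹ - 1) := by gcongr
      _ = 1 - p := by field_simp
      _ ≤ 1 := by linarith
  have h3 : (0.5 : ℝ) < Real.log 2 := by linarith [Real.log_two_gt_d9]
  unfold Real.logb
  rw [← neg_div, ← mul_div_assoc, div_le_iff₀ (by linarith)]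
  linarith

/-- main termwise estimate: `p = μ²`, `ρ` ratio, `J` multiplicity. -/
lemma term_bound (K mu rho q p A B : ℝ) (hmu : 0 < mu) (hmu1 : mu ≤ 1) (hK : 1 ≤ K)
    (hr1 : 1 / K ≤ rho) (hr2 : rho ≤ K) (hp : 0 ≤ p) (hq : 0 ≤ q) (hqB : q ≤ B * p)
    (D : ℝ) (hD : A * p * (-Real.logb 2 mu) ≤ q * (-Real.logb 2 mu) + D) :
    q * (-Real.logb 2 (mu * rho)) ≤ B * (p * (-Real.logb 2 mu)) + Real.logb 2 K * B * p ∧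
    A * (p * (-Real.logb 2 mu)) - Real.logb 2 K * B * p - D ≤ q * (-Real.logb 2 (mu * rho)) := by
  have hK0 : 0 < K := by linarith
  have hr0 : 0 < rho := lt_of_lt_of_le (by positivity) hr1
  rw [Real.logb_mul hmu.ne' hr0.ne']
  have l1 : Real.logb 2 rho ≤ Real.logb 2 K := Real.logb_le_logb_of_le (by norm_num) hr0 hr2
  have l2 : -Real.logb 2 K ≤ Real.logb 2 rho := by
    rw [← Real.logb_inv]
    exact Real.logb_le_logb_of_le (by norm_num) (by positivity) (by simpa using hr1)
  have l3 : 0 ≤ Real.logb 2 K := Real.logb_nonneg (by norm_num) hK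
  have l4 : Real.logb 2 mu ≤ 0 := Real.logb_nonpos (by norm_num) hmu.le hmu1
  set a := Real.logb 2 mu
  set b := Real.logb 2 rho
  set L := Real.logb 2 K
  have m1 : q * (-a) ≤ B * p * (-a) := mul_le_mul_of_nonneg_right hqB (by linarith)
  have m2 : q * L ≤ B * p * L := mul_le_mul_of_nonneg_right hqB l3
  have m3 : q * (-b) ≤ q * L := mul_le_mul_of_nonneg_left (by linarith) hq
  have m4 : q * (-L) ≤ q * (-b) := mul_le_mul_of_nonneg_left (by linarith) hq
  constructor <;> nlinarith

lemma main_aux (s : ℕ) (hs : 2 ≤ s) (n : ℕ) (x : ℕ → List (Fin (s + 1))) (h0 : x 0 = [])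
    (hx : ∀ k, 1 ≤ k → k ≤ n → (x k).length = 2 * k ∧ (x k).IsChain (· ≠ ·)) (k : ℕ) (hk : k ≤ n) :
    ((Imult (s + 1) k : ℝ) * lamSq (s + 1) n x k * (-Real.logb 2 (lamSq (s + 1) n x k)) ≤
      (((s : ℝ) + 1) / (s - 1)) ^ 2 * ((Jmult s k : ℝ) * muSq s n k * (-Real.logb 2 (muSq s n k)))
        + Real.logb 2 ((s : ℝ) * (s + 1) / (s - 1) ^ 2) * (((s : ℝ) + 1) / (s - 1)) ^ 2 *
          ((Jmult s k : ℝ) * muSq s n k)) ∧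
    ((((s : ℝ) - 1) / s) ^ 2 * ((Jmult s k : ℝ) * muSq s n k * (-Real.logb 2 (muSq s n k)))
        - Real.logb 2 ((s : ℝ) * (s + 1) / (s - 1) ^ 2) * (((s : ℝ) + 1) / (s - 1)) ^ 2 *
          ((Jmult s k : ℝ) * muSq s n k) - (if k = 0 then 2 else 0) ≤
      (Imult (s + 1) k : ℝ) * lamSq (s + 1) n x k * (-Real.logb 2 (lamSq (s + 1) n x k))) := by
  have hs' : (2 : ℝ) ≤ s := by exact_mod_cast hs
  have hs1 : (0 : ℝ) < s - 1 := by linarith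
  have hF : (0 : ℝ) < pathF s (4 * n) 0 := by
    rw [pathF_eq s (4 * n) (2 * n) 0 (by omega)]
    have := Cnk_pos (2 * n) 0
    positivity
  have hFk : (0 : ℝ) < pathF s (2 * n) (2 * k) := by
    rw [pathF_eq s (2 * n) (n - k) (2 * k) (by omega)]
    have := Cnk_pos (n - k) (2 * k)
    positivity
  have hmu : 0 < muSq s n k := by rw [muSq_eq s n k hk]; positivity
  have hJ1 : (1 : ℝ) ≤ Jmult s k := by
    have : 1 ≤ Jmult s k := by
      unfold Jmult; split_ifs
      · exact le_rfl
      · exact Nat.one_le_pow _ _ (by omega)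
    exact_mod_cast this
  have hmuJ : (Jmult s k : ℝ) * muSq s n k ≤ 1 := by
    refine le_trans ?_ (sum_muSq s n (by omega))
    refine Finset.single_le_sum (f := fun k => (Jmult s k : ℝ) * muSq s n k) ?_
      (Finset.mem_range.2 (by omega))
    intro i hi
    have : 0 ≤ muSq s n i := by
      rw [muSq_eq s n i (by simpa [Nat.lt_succ_iff] using hi)]; positivity
    positivity
  have hmu1 : muSq s n k ≤ 1 := by nlinarith
  have hxk : (x k).length = 2 * k ∧ (x k).IsChain (· ≠ ·) := by
    rcases Nat.eq_zero_or_pos k with rfl | h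
    · simp [h0]
    · exact hx k h hk
  set r := ratR s (n - k) (2 * k) with hr
  set R := ratR s (2 * n) 0 with hR
  set K := (s : ℝ) * (s + 1) / (s - 1) ^ 2 with hKdef
  have r1 : 1 ≤ r := one_le_ratR _ _ _
  have R1 : 1 ≤ R := one_le_ratR _ _ _
  have rR : r ≤ R := ratR_mono _ _ _ _ (by omega)
  have RK : R ≤ K := ratR_le _ _ _ hs
  have hK : 1 ≤ K := R1.trans RK
  have hlam : lamSq (s + 1) n x k = muSq s n k * (r ^ 2 / R) := by
    unfold lamSq
    rw [Wx_eq s _ _ hxk.2, W_eq, hxk.1, muSq_eq s n k hk]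
    have g1 := pathG_ratio s (n - k) (2 * k) (by omega)
    rw [show 2 * (n - k) + 2 * k = 2 * n by omega] at g1
    have g2 := pathG_ratio s (2 * n) 0 (by omega)
    rw [Nat.add_zero] at g2
    rw [← hr] at g1
    rw [← hR] at g2
    rw [g1, g2, show 2 * (2 * n) = 4 * n by ring]
    have : R ≠ 0 := by positivity
    field_simp
  have rho1 : 1 / K ≤ r ^ 2 / R := by
    rw [div_le_div_iff₀ (by linarith) (by linarith)]
    have : 1 ≤ r ^ 2 := one_le_pow₀ r1
    nlinarith
  have rho2 : r ^ 2 / R ≤ K := by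
    rw [div_le_iff₀ (by linarith)]
    nlinarith
  rw [hlam]
  set mu := muSq s n k
  set rho := r ^ 2 / R
  have rho0 : 0 < rho := lt_of_lt_of_le (by positivity) rho1
  have hI : (0 : ℝ) ≤ Imult (s + 1) k := by positivity
  have l4 : Real.logb 2 mu ≤ 0 := Real.logb_nonpos (by norm_num) hmu.le hmu1
  have hc : (1 : ℝ) ≤ (s + 1) / s := by rw [le_div_iff₀ (by linarith)]; linarith
  have hBK : (((s : ℝ) + 1) / (s - 1)) ^ 2 = (s + 1) / s * K := by
    rw [hKdef]; field_simp
  have hAK : (((s : ℝ) - 1) / s) ^ 2 = (s + 1) / s * (1 / K) := by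
    rw [hKdef]; field_simp
  apply term_bound K mu rho _ _ _ _ hmu hmu1 hK rho1 rho2
  · positivity
  · positivity
  · rw [hBK]
    rcases Nat.eq_zero_or_pos k with h | h
    · have hI1 : (Imult (s + 1) k : ℝ) = 1 := by simp [Imult, h]
      have hJ' : (Jmult s k : ℝ) = 1 := by simp [Jmult, h]
      rw [hI1, hJ', one_mul, one_mul, mul_comm]
      apply mul_le_mul_of_nonneg_right _ hmu.le
      nlinarith
    · rw [Imult_eq s k (by omega) (by omega)]
      calc ((s : ℝ) + 1) / s * Jmult s k * (mu * rho) = ((s : ℝ) + 1) / s * rho * (Jmult s k * mu) := by ring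
        _ ≤ _ := by gcongr
  · rcases Nat.eq_zero_or_pos k with h | h
    · have hJ' : (Jmult s k : ℝ) = 1 := by simp [Jmult, h]
      rw [if_pos h, hJ', one_mul]
      have hA1 : (((s : ℝ) - 1) / s) ^ 2 ≤ 1 := by
        apply pow_le_one₀ (by positivity)
        rw [div_le_one (by linarith)]; linarith
      have hA0 : 0 ≤ (((s : ℝ) - 1) / s) ^ 2 := by positivity
      have e1 := neg_mul_logb_le mu hmu
      have e2 : 0 ≤ mu * (-Real.logb 2 mu) := mul_nonneg hmu.le (by linarith)
      have e3 : 0 ≤ (Imult (s + 1) k : ℝ) * (mu * rho) * (-Real.logb 2 mu) :=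
        mul_nonneg (by positivity) (by linarith)
      nlinarith
    · rw [if_neg (by omega), add_zero]
      apply mul_le_mul_of_nonneg_right _ (by linarith)
      rw [hAK, Imult_eq s k (by omega) (by omega)]
      calc ((s : ℝ) + 1) / s * (1 / K) * (Jmult s k * mu) ≤ ((s : ℝ) + 1) / s * rho * (Jmult s k * mu) := by
            gcongr
        _ = _ := by ring

/-- for `d ≥ 3` and `s = d − 1`, there is a constant `C > 0` such that
for all `n ≥ 1` (and any choice of irreducible strings `x k` of length `2k`, `x 0 = []`):
`S_n^{PF} ≥ ((d−2)/(d−1))² · S_n^{D} − C` and `S_n^{PF} ≤ (d/(d−2))² · S_n^{D} + C`. -/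
theorem pf_entropy_comparison (d : ℕ) (hd : 3 ≤ d) :
    ∃ C : ℝ, 0 < C ∧ ∀ n : ℕ, 1 ≤ n →
      ∀ x : ℕ → List (Fin d), x 0 = [] →
        (∀ k, 1 ≤ k → k ≤ n → (x k).length = 2 * k ∧ (x k).Chain' (· ≠ ·)) →
        SPF d n x ≥ (((d : ℝ) - 2) / ((d : ℝ) - 1)) ^ 2 * SD (d - 1) n - C ∧
        SPF d n x ≤ ((d : ℝ) / ((d : ℝ) - 2)) ^ 2 * SD (d - 1) n + C := by
  obtain ⟨s, rfl⟩ : ∃ s, d = s + 1 := ⟨d - 1, by omega⟩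
  have hs : 2 ≤ s := by omega
  have hs' : (2 : ℝ) ≤ s := by exact_mod_cast hs
  have hs1 : (0 : ℝ) < s - 1 := by linarith
  set L := Real.logb 2 ((s : ℝ) * (s + 1) / (s - 1) ^ 2) with hL
  set B := (((s : ℝ) + 1) / (s - 1)) ^ 2 with hB
  have hL0 : 0 ≤ L := by
    apply Real.logb_nonneg (by norm_num)
    rw [le_div_iff₀ (by positivity)]
    nlinarith
  have hB0 : 0 ≤ B := by positivity
  refine ⟨L * B + 3, by positivity, ?_⟩
  intro n hn x h0 hx
  have key := main_aux s hs n x h0 hx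
  have hsum := sum_muSq s n (by omega)
  have hLB : L * B * ∑ k ∈ Finset.range (n + 1), (Jmult s k : ℝ) * muSq s n k ≤ L * B := by
    have := mul_le_mul_of_nonneg_left hsum (mul_nonneg hL0 hB0)
    linarith
  have eP : SPF (s + 1) n x = ∑ k ∈ Finset.range (n + 1),
      (Imult (s + 1) k : ℝ) * lamSq (s + 1) n x k * (-Real.logb 2 (lamSq (s + 1) n x k)) := by
    unfold SPF
    rw [← Finset.sum_neg_distrib]
    apply Finset.sum_congr rfl
    intro k _; ring
  have eD : SD (s + 1 - 1) n = ∑ k ∈ Finset.range (n + 1),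
      (Jmult s k : ℝ) * muSq s n k * (-Real.logb 2 (muSq s n k)) := by
    unfold SD
    rw [Nat.add_sub_cancel, ← Finset.sum_neg_distrib]
    apply Finset.sum_congr rfl
    intro k _; ring
  have c1 : (((s + 1 : ℕ) : ℝ) - 2) / (((s + 1 : ℕ) : ℝ) - 1) = ((s : ℝ) - 1) / s := by
    push_cast; congr 1 <;> ring
  have c2 : ((s + 1 : ℕ) : ℝ) / (((s + 1 : ℕ) : ℝ) - 2) = ((s : ℝ) + 1) / (s - 1) := by
    push_cast; congr 1; ring
  rw [c1, c2, eP, eD]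
  constructor
  · have := Finset.sum_le_sum fun k (hk : k ∈ Finset.range (n + 1)) =>
      (key k (by simpa [Nat.lt_succ_iff] using hk)).2
    rw [Finset.sum_sub_distrib, Finset.sum_sub_distrib, ← Finset.mul_sum, ← Finset.mul_sum,
      Finset.sum_ite_eq' (Finset.range (n + 1)) 0 (fun _ => (2 : ℝ)), if_pos (by simp)] at this
    linarith
  · have := Finset.sum_le_sum fun k (hk : k ∈ Finset.range (n + 1)) =>
      (key k (by simpa [Nat.lt_succ_iff] using hk)).1
    rw [Finset.sum_add_distrib, ← Finset.mul_sum, ← Finset.mul_sum] at this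
    linarith
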